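/- Let f : [0,∞) → [0,∞) be continuous, and suppose there exists c > 0 such that t² f(t) ≤ ∫₀^t r f(r) dr + c for all t > 0. Then there exists a constant C > 0 such that f(t) ≤ C / t for all t ≥ 1. -/

import Mathlib

open MeasureTheory Filter Set

/-- If `t * G' t ≤ G t` on `[1, ∞)`, then `G` grows at most linearly there. -/
theorem le_mul_of_mul_deriv_le {G G' : ℝ → ℝ}
    (hG : ∀ t, 1 ≤ t → HasDerivAt G (G' t) t) (hle : ∀ t, 1 ≤ t → t * G' t ≤ G t)
    {t : ℝ} (ht : 1 ≤ t) : G t ≤ G 1 * t := by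
  have hder : ∀ s : ℝ, 1 ≤ s →
      HasDerivAt (fun x => G x / x) ((G' s * s - G s * 1) / s ^ 2) s := fun s hs =>
    (hG s hs).div (hasDerivAt_id s) (by positivity)
  have hanti : AntitoneOn (fun x => G x / x) (Ici (1 : ℝ)) := by
    refine antitoneOn_of_deriv_nonpos (convex_Ici 1)
      (fun s hs => (hder s hs).continuousAt.continuousWithinAt)
      (fun s hs => (hder s (interior_subset hs)).differentiableAt.differentiableWithinAt)
      fun s hs => ?_
    have hs1 : 1 ≤ s := interior_subset hs
    rw [(hder s hs1).deriv]
    exact div_nonpos_of_nonpos_of_nonneg (by linarith [hle s hs1]) (sq_nonneg s)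
  have h1 : G t / t ≤ G 1 / 1 := hanti self_mem_Ici ht ht
  rwa [div_one, div_le_iff₀ (by positivity)] at h1

/-- a Gronwall-type lemma: if `f ≥ 0` is continuous on `[0,∞)` and
`t² f(t) ≤ ∫₀ᵗ r f(r) dr + c` for all `t > 0`, then `f(t) ≤ C/t` for `t ≥ 1`. -/
theorem gronwall_decay
    (f : ℝ → ℝ) (hf : ContinuousOn f (Ici 0)) (hf0 : ∀ t, 0 ≤ t → 0 ≤ f t)
    (c : ℝ) (hc : 0 < c)
    (h : ∀ t, 0 < t → t ^ 2 * f t ≤ (∫ r in Ioc (0:ℝ) t, r * f r) + c) :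
    ∃ C > (0:ℝ), ∀ t, 1 ≤ t → f t ≤ C / t := by
  have hcont : Continuous fun r : ℝ => r * f (max r 0) :=
    continuous_id.mul (hf.comp_continuous (by fun_prop) fun r => le_max_right r 0)
  set G : ℝ → ℝ := fun t => (∫ r in (0:ℝ)..t, r * f (max r 0)) + c with hGdef
  have hG : ∀ t, 0 ≤ t → G t = (∫ r in Ioc (0:ℝ) t, r * f r) + c := by
    intro t ht
    simp only [hGdef, intervalIntegral.integral_of_le ht]
    congr 1
    exact setIntegral_congr_fun measurableSet_Ioc fun r hr => by simp [max_eq_left hr.1.le]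
  have hder : ∀ t, 1 ≤ t → HasDerivAt G (t * f (max t 0)) t := fun t _ =>
    (hcont.integral_hasStrictDerivAt 0 t).hasDerivAt.add_const c
  have hbound : ∀ t, 1 ≤ t → t ^ 2 * f t ≤ G t := fun t ht => by
    rw [hG t (by positivity)]
    exact h t (by positivity)
  refine ⟨G 1, ?_, fun t ht => ?_⟩
  · rw [hG 1 zero_le_one]
    have : 0 ≤ ∫ r in Ioc (0:ℝ) 1, r * f r :=
      setIntegral_nonneg measurableSet_Ioc fun r hr => mul_nonneg hr.1.le (hf0 r hr.1.le)
    linarith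
  · have ht0 : 0 < t := by positivity
    have hlin : G t ≤ G 1 * t := le_mul_of_mul_deriv_le hder (fun s hs => by
      rw [max_eq_left (by positivity)]
      linarith [hbound s hs]) ht
    rw [le_div_iff₀ ht0]
    refine le_of_mul_le_mul_right ?_ ht0
    linarith [hbound t ht]
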